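/- arXiv:1403.5901 — 5 statements merged into one kernel-verified Lean document; each statement's English description precedes it below -/
import Mathlib

section
/- Let N be a norm on the space of real m×n matrices and let A be a nonzero m×n real matrix. The set of optimal solutions of the problem min{ N(X) : ⟨A, X⟩ ≥ 1 } equals (N*(A))⁻¹ · ∂N*(A), i.e., it is the set of matrices of the form (N*(A))⁻¹ G where G is a subgradient of the dual norm function N* at A. -/
open Matrix Pointwise

noncomputable section

/-- The Frobenius (trace) inner product of two real `m × n` matrices. -/
def fip {m n : ℕ} (A X : Matrix (Fin m) (Fin n) ℝ) : ℝ := (Aᵀ * X).trace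

/-- `N` is a norm on the space of real `m × n` matrices. -/
structure IsMatrixNorm {m n : ℕ} (N : Matrix (Fin m) (Fin n) ℝ → ℝ) : Prop where
  nonneg : ∀ X, 0 ≤ N X
  definite : ∀ X, N X = 0 → X = 0
  smul : ∀ (c : ℝ) (X), N (c • X) = |c| * N X
  triangle : ∀ X Y, N (X + Y) ≤ N X + N Y

/-- The dual norm `N*(A) = sup { ⟨A, Y⟩ : N(Y) ≤ 1 }`. -/
def dualNorm {m n : ℕ} (N : Matrix (Fin m) (Fin n) ℝ → ℝ)
    (A : Matrix (Fin m) (Fin n) ℝ) : ℝ :=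
  sSup {r | ∃ Y, N Y ≤ 1 ∧ r = fip A Y}

/-- The subdifferential of `f : ℝ^{m×n} → ℝ` at `X`, with respect to the Frobenius
inner product. -/
def msubdiff {m n : ℕ} (f : Matrix (Fin m) (Fin n) ℝ → ℝ)
    (X : Matrix (Fin m) (Fin n) ℝ) : Set (Matrix (Fin m) (Fin n) ℝ) :=
  {G | ∀ Y, f X + fip G (Y - X) ≤ f Y}

section FiniteDimensional

variable {E : Type*} [AddCommGroup E] [Module ℝ E]

/-- On a finite-dimensional space, a linear functional is bounded with respect to any norm. -/
theorem exists_bound_of_isNorm [FiniteDimensional ℝ E] (N : E → ℝ)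
    (nonneg : ∀ x, 0 ≤ N x) (definite : ∀ x, N x = 0 → x = 0)
    (smul : ∀ (c : ℝ) x, N (c • x) = |c| * N x)
    (triangle : ∀ x y, N (x + y) ≤ N x + N y) (f : E →ₗ[ℝ] ℝ) :
    ∃ C, ∀ x, f x ≤ C * N x := by
  let : Norm E := ⟨N⟩
  have core : NormedSpace.Core ℝ E :=
    { norm_nonneg := nonneg
      norm_smul := smul
      norm_triangle := triangle
      norm_eq_zero_iff := fun x =>
        ⟨definite x, fun h => by
          rw [h]
          have h0 := smul 0 0
          rw [zero_smul, abs_zero, zero_mul] at h0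
          exact h0⟩ }
  let := NormedAddCommGroup.ofCore core
  let := NormedSpace.ofCore core
  exact ⟨‖LinearMap.toContinuousLinearMap f‖, fun x =>
    (le_abs_self _).trans ((LinearMap.toContinuousLinearMap f).le_opNorm x)⟩

/-- A norm has a supporting linear functional at every point. -/
theorem exists_support_of_isNorm (N : E → ℝ)
    (nonneg : ∀ x, 0 ≤ N x) (smul : ∀ (c : ℝ) x, N (c • x) = |c| * N x)
    (triangle : ∀ x y, N (x + y) ≤ N x + N y) (x : E) (hx : x ≠ 0) :
    ∃ g : E →ₗ[ℝ] ℝ, g x = N x ∧ ∀ y, g y ≤ N y := by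
  obtain ⟨g, hg, hgN⟩ := exists_extension_of_le_sublinear
    (LinearPMap.mkSpanSingleton x (N x) hx) N
    (fun c hc y => by rw [smul, abs_of_pos hc]) triangle (by
      rintro ⟨y, hy⟩
      obtain ⟨c, rfl⟩ := Submodule.mem_span_singleton.1 hy
      rw [LinearPMap.mkSpanSingleton'_apply, smul, smul_eq_mul]
      exact mul_le_mul_of_nonneg_right (le_abs_self c) (nonneg x))
  refine ⟨g, ?_, hgN⟩
  have h := hg ⟨x, Submodule.mem_span_singleton_self x⟩
  rwa [LinearPMap.mkSpanSingleton_apply] at h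

end FiniteDimensional

section Fip

variable {m n : ℕ}

theorem fip_eq_sum (A X : Matrix (Fin m) (Fin n) ℝ) : fip A X = ∑ j, ∑ i, A i j * X i j := by
  simp [fip, Matrix.trace, Matrix.mul_apply]

theorem fip_comm (A X : Matrix (Fin m) (Fin n) ℝ) : fip A X = fip X A := by
  simp only [fip_eq_sum, mul_comm]

theorem fip_add (A X Y : Matrix (Fin m) (Fin n) ℝ) : fip A (X + Y) = fip A X + fip A Y := by
  simp [fip, Matrix.mul_add]

theorem fip_sub (A X Y : Matrix (Fin m) (Fin n) ℝ) : fip A (X - Y) = fip A X - fip A Y := by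
  simp [fip, Matrix.mul_sub]

theorem fip_smul (A : Matrix (Fin m) (Fin n) ℝ) (c : ℝ) (X : Matrix (Fin m) (Fin n) ℝ) :
    fip A (c • X) = c * fip A X := by
  simp [fip]

theorem fip_self_pos {A : Matrix (Fin m) (Fin n) ℝ} (hA : A ≠ 0) : 0 < fip A A := by
  have hnn : 0 ≤ fip A A := by
    rw [fip_eq_sum]
    exact Finset.sum_nonneg fun j _ => Finset.sum_nonneg fun i _ => mul_self_nonneg _
  refine lt_of_le_of_ne hnn fun h => hA ?_
  rw [fip_eq_sum, eq_comm, Finset.sum_eq_zero_iff_of_nonneg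
    (fun j _ => Finset.sum_nonneg fun i _ => mul_self_nonneg _)] at h
  ext i j
  have hj := h j (Finset.mem_univ j)
  rw [Finset.sum_eq_zero_iff_of_nonneg (fun i _ => mul_self_nonneg _)] at hj
  exact mul_self_eq_zero.1 (hj i (Finset.mem_univ i))

/-- The functional `X ↦ ⟨A, X⟩` as a linear map. -/
def fipLinear (A : Matrix (Fin m) (Fin n) ℝ) : Matrix (Fin m) (Fin n) ℝ →ₗ[ℝ] ℝ where
  toFun := fip A
  map_add' := fip_add A
  map_smul' := fip_smul A

/-- Every linear functional on matrices is represented by the Frobenius inner product. -/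
theorem exists_fip_eq (g : Matrix (Fin m) (Fin n) ℝ →ₗ[ℝ] ℝ) :
    ∃ B, ∀ X, g X = fip B X := by
  refine ⟨Matrix.of fun i j => g (Matrix.single i j 1), fun X => ?_⟩
  rw [fip_eq_sum, Finset.sum_comm]
  conv_lhs => rw [Matrix.matrix_eq_sum_single X]
  simp only [map_sum, Matrix.of_apply]
  refine Finset.sum_congr rfl fun i _ => Finset.sum_congr rfl fun j _ => ?_
  have h : Matrix.single i j (X i j) = X i j • Matrix.single i j (1 : ℝ) := by
    rw [Matrix.smul_single, smul_eq_mul, mul_one]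
  rw [h, map_smul, smul_eq_mul, mul_comm]

end Fip

namespace IsMatrixNorm

variable {m n : ℕ} {N : Matrix (Fin m) (Fin n) ℝ → ℝ}

theorem map_zero (hN : IsMatrixNorm N) : N 0 = 0 := by
  simpa using hN.smul 0 0

theorem pos (hN : IsMatrixNorm N) {X : Matrix (Fin m) (Fin n) ℝ} (hX : X ≠ 0) : 0 < N X :=
  lt_of_le_of_ne (hN.nonneg X) fun h => hX (hN.definite X h.symm)

theorem bddAbove_dual (hN : IsMatrixNorm N) (A : Matrix (Fin m) (Fin n) ℝ) :
    BddAbove {r | ∃ Y, N Y ≤ 1 ∧ r = fip A Y} := by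
  obtain ⟨C, hC⟩ := exists_bound_of_isNorm N hN.nonneg hN.definite hN.smul hN.triangle
    (fipLinear A)
  refine ⟨|C|, ?_⟩
  rintro r ⟨Y, hY, rfl⟩
  calc fip A Y ≤ C * N Y := hC Y
    _ ≤ |C| * N Y := mul_le_mul_of_nonneg_right (le_abs_self C) (hN.nonneg Y)
    _ ≤ |C| := mul_le_of_le_one_right (abs_nonneg C) hY

theorem fip_le_dualNorm (hN : IsMatrixNorm N) (A : Matrix (Fin m) (Fin n) ℝ)
    {Y : Matrix (Fin m) (Fin n) ℝ} (hY : N Y ≤ 1) : fip A Y ≤ dualNorm N A :=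
  le_csSup (hN.bddAbove_dual A) ⟨Y, hY, rfl⟩

theorem dualNorm_le (hN : IsMatrixNorm N) {A : Matrix (Fin m) (Fin n) ℝ} {c : ℝ}
    (h : ∀ Y, N Y ≤ 1 → fip A Y ≤ c) : dualNorm N A ≤ c := by
  refine csSup_le ⟨_, 0, by simp [hN.map_zero], rfl⟩ ?_
  rintro r ⟨Y, hY, rfl⟩
  exact h Y hY

/-- The generalized Cauchy–Schwarz inequality. -/
theorem fip_le_dualNorm_mul (hN : IsMatrixNorm N) (A Y : Matrix (Fin m) (Fin n) ℝ) :
    fip A Y ≤ dualNorm N A * N Y := by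
  by_cases hY : Y = 0
  · simp [hY, hN.map_zero, fip]
  have hp := hN.pos hY
  have h := hN.fip_le_dualNorm A (Y := (N Y)⁻¹ • Y) (by
    rw [hN.smul, abs_of_pos (inv_pos.2 hp), inv_mul_cancel₀ hp.ne'])
  rwa [fip_smul, inv_mul_le_iff₀ hp, mul_comm] at h

theorem dualNorm_pos (hN : IsMatrixNorm N) {A : Matrix (Fin m) (Fin n) ℝ} (hA : A ≠ 0) :
    0 < dualNorm N A :=
  pos_of_mul_pos_left ((fip_self_pos hA).trans_le (hN.fip_le_dualNorm_mul A A)) (hN.nonneg A)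

/-- A matrix whose pairing with every `B` is at most `N*(B)` lies in the unit ball of `N`. -/
theorem le_one_of_fip_le_dualNorm (hN : IsMatrixNorm N) {G : Matrix (Fin m) (Fin n) ℝ}
    (h : ∀ B, fip G B ≤ dualNorm N B) : N G ≤ 1 := by
  by_cases hG : G = 0
  · simp [hG, hN.map_zero]
  obtain ⟨g, hgG, hg⟩ := exists_support_of_isNorm N hN.nonneg hN.smul hN.triangle G hG
  obtain ⟨B, hB⟩ := exists_fip_eq g
  calc N G = fip G B := by rw [← hgG, hB, fip_comm]
    _ ≤ dualNorm N B := h B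
    _ ≤ 1 := hN.dualNorm_le fun Y hY => by
      rw [← hB]
      exact (hg Y).trans hY

/-- The subgradients of `N*` at `A` are the points of the unit ball of `N` at which
`⟨A, ·⟩` attains `N*(A)`. -/
theorem mem_msubdiff_dualNorm_iff (hN : IsMatrixNorm N) (A G : Matrix (Fin m) (Fin n) ℝ) :
    G ∈ msubdiff (dualNorm N) A ↔ N G ≤ 1 ∧ fip A G = dualNorm N A := by
  constructor
  · intro h
    have h0 := h 0
    have h2 := h ((2 : ℝ) • A)
    have d0 : dualNorm N 0 ≤ 0 := hN.dualNorm_le fun Y _ => by simp [fip]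
    have d2 : dualNorm N ((2 : ℝ) • A) ≤ 2 * dualNorm N A := hN.dualNorm_le fun Y hY => by
      rw [fip_comm, fip_smul, fip_comm]
      exact mul_le_mul_of_nonneg_left (hN.fip_le_dualNorm A hY) zero_le_two
    have z : fip G 0 = 0 := by simp [fip]
    rw [fip_sub] at h0 h2
    rw [fip_smul] at h2
    have hGA : fip G A = dualNorm N A := by linarith
    refine ⟨hN.le_one_of_fip_le_dualNorm fun B => ?_, by rw [fip_comm, hGA]⟩
    have hB := h B
    rw [fip_sub] at hB
    linarith
  · rintro ⟨hG, hAG⟩ Y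
    have hY := hN.fip_le_dualNorm Y hG
    rw [fip_sub, fip_comm G Y, fip_comm G A]
    linarith

end IsMatrixNorm

/-- The set of optimal solutions of `min { N(X) : ⟨A, X⟩ ≥ 1 }` equals
`(N*(A))⁻¹ • ∂N*(A)`. -/
theorem stmt2 {m n : ℕ} (N : Matrix (Fin m) (Fin n) ℝ → ℝ) (hN : IsMatrixNorm N)
    (A : Matrix (Fin m) (Fin n) ℝ) (hA : A ≠ 0) :
    {X | 1 ≤ fip A X ∧ ∀ X', 1 ≤ fip A X' → N X ≤ N X'} =
      (dualNorm N A)⁻¹ • msubdiff (dualNorm N) A := by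
  have hD := hN.dualNorm_pos hA
  ext X
  rw [Set.mem_inv_smul_set_iff₀ hD.ne', hN.mem_msubdiff_dualNorm_iff, hN.smul, abs_of_pos hD,
    fip_smul, Set.mem_ofPred_eq]
  constructor
  · rintro ⟨hX, hmin⟩
    have hle := hN.fip_le_dualNorm_mul A X
    have hNX : 0 < N X := pos_of_mul_pos_right (by linarith) hD.le
    have hD1 : dualNorm N A ≤ (N X)⁻¹ := hN.dualNorm_le fun Y hY => by
      rcases le_or_gt (fip A Y) 0 with hneg | hpos
      · exact hneg.trans (inv_pos.2 hNX).le
      have h := hmin ((fip A Y)⁻¹ • Y) (by rw [fip_smul, inv_mul_cancel₀ hpos.ne'])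
      rw [hN.smul, abs_of_pos (inv_pos.2 hpos)] at h
      rw [le_inv_comm₀ hpos hNX]
      exact h.trans (mul_le_of_le_one_right (inv_pos.2 hpos).le hY)
    have hDX : dualNorm N A * N X ≤ 1 := by
      rwa [← le_div_iff₀ hNX, one_div]
    have hAX : fip A X = 1 := by linarith
    exact ⟨hDX, by rw [hAX, mul_one]⟩
  · rintro ⟨hDX, hAX⟩
    have h1 : fip A X = 1 := mul_left_cancel₀ hD.ne' (by rw [hAX, mul_one])
    refine ⟨h1.ge, fun X' hX' => le_of_mul_le_mul_left ?_ hD⟩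
    exact hDX.trans (hX'.trans (hN.fip_le_dualNorm_mul A X'))
end
end

section
/- Let σ ∈ ℝ^p be a nonzero vector with σ₁ ≥ σ₂ ≥ ⋯ ≥ σ_p ≥ 0, and let integers k, s, t satisfy 1 ≤ k ≤ p, 1 ≤ t ≤ k, 0 ≤ s ≤ p − k, σ_{k−t+1} = σ_{k+s}, σ_{k−t} > σ_{k−t+1} whenever k − t ≥ 1, and σ_{k+s} > σ_{k+s+1} whenever k + s < p (so the multiplicity of σ_k among the entries is s + t). Then v ∈ ℝ^p is a subgradient of the norm ‖·‖_{k,2} at σ if and only if: (i) v_i = σ_i / ‖σ‖_{k,2} for all i = 1, …, k − t; (ii) there exist τ_i ∈ [0, 1] for i = k − t + 1, …, k + s with Σ_{i=k−t+1}^{k+s} τ_i = t and v_i = τ_i σ_k / ‖σ‖_{k,2} for those i; and (iii) v_i = 0 for all i = k + s + 1, …, p. -/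
noncomputable section

/-- The gauge norm `‖x‖_{k,2}`: the maximum over `k`-element subsets `S` of
`(∑_{i ∈ S} x_i²)^{1/2}`. -/
def vecKyFan2k {p : ℕ} (k : ℕ) (x : Fin p → ℝ) : ℝ :=
  sSup {r | ∃ S : Finset (Fin p), S.card = k ∧ r = Real.sqrt (∑ i ∈ S, x i ^ 2)}

/-- The subdifferential of `f : ℝ^p → ℝ` at `x`, with respect to the Euclidean
inner product. -/
def vsubdiff {p : ℕ} (f : (Fin p → ℝ) → ℝ) (x : Fin p → ℝ) : Set (Fin p → ℝ) :=
  {v | ∀ y, f x + ∑ i, v i * (y i - x i) ≤ f y}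

section KyFan

variable {p k : ℕ}

lemma vecKyFan2k_bddAbove (k : ℕ) (x : Fin p → ℝ) :
    BddAbove {r | ∃ S : Finset (Fin p), S.card = k ∧ r = Real.sqrt (∑ i ∈ S, x i ^ 2)} := by
  refine ⟨Real.sqrt (∑ i, x i ^ 2), ?_⟩
  rintro r ⟨S, -, rfl⟩
  exact Real.sqrt_le_sqrt (Finset.sum_le_univ_sum_of_nonneg fun i => sq_nonneg (x i))

lemma vecKyFan2k_nonneg (k : ℕ) (x : Fin p → ℝ) : 0 ≤ vecKyFan2k k x := by
  apply Real.sSup_nonneg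
  rintro r ⟨S, -, rfl⟩
  exact Real.sqrt_nonneg _

lemma sum_sq_le_vecKyFan2k_sq (x : Fin p → ℝ) {S : Finset (Fin p)} (hS : S.card = k) :
    ∑ i ∈ S, x i ^ 2 ≤ vecKyFan2k k x ^ 2 := by
  rw [← Real.sqrt_le_left (vecKyFan2k_nonneg k x)]
  exact le_csSup (vecKyFan2k_bddAbove k x) ⟨S, hS, rfl⟩

lemma vecKyFan2k_sq_le (hk : k ≤ p) (x : Fin p → ℝ) {b : ℝ}
    (h : ∀ S : Finset (Fin p), S.card = k → ∑ i ∈ S, x i ^ 2 ≤ b) :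
    vecKyFan2k k x ^ 2 ≤ b := by
  obtain ⟨S, -, hS⟩ := Finset.exists_subset_card_eq
    (show k ≤ (Finset.univ : Finset (Fin p)).card by simpa using hk)
  have hb : 0 ≤ b := (Finset.sum_nonneg fun i _ => sq_nonneg (x i)).trans (h S hS)
  rw [← Real.le_sqrt (vecKyFan2k_nonneg k x) hb]
  refine csSup_le ⟨_, S, hS, rfl⟩ ?_
  rintro r ⟨T, hT, rfl⟩
  exact Real.sqrt_le_sqrt (h T hT)

/-- Thresholding bound: the sum over a `k`-set is at most `k c + ∑ (z_i - c)⁺`. -/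
lemma sum_le_threshold (z : Fin p → ℝ) (c : ℝ) {S : Finset (Fin p)} (hS : S.card = k) :
    ∑ i ∈ S, z i ≤ k * c + ∑ i, max (z i - c) 0 := by
  calc ∑ i ∈ S, z i = k * c + ∑ i ∈ S, (z i - c) := by
        rw [Finset.sum_sub_distrib]; simp [hS]
    _ ≤ k * c + ∑ i ∈ S, max (z i - c) 0 := by
        gcongr; exact le_max_left _ _
    _ ≤ _ := by
        have := Finset.sum_le_univ_sum_of_nonneg (s := S) fun i => le_max_right (z i - c) 0
        linarith

/-- A linear form with weights in `[0, 1]` of total mass `k` is dominated by some `k`-set. -/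
lemma exists_card_eq_weighted_sum_le (hk1 : 1 ≤ k) (hk : k ≤ p) (z w : Fin p → ℝ)
    (hw0 : ∀ i, 0 ≤ w i) (hw1 : ∀ i, w i ≤ 1) (hw : ∑ i, w i = k) :
    ∃ S : Finset (Fin p), S.card = k ∧ ∑ i, w i * z i ≤ ∑ i ∈ S, z i := by
  have hne : (Finset.powersetCard k (Finset.univ : Finset (Fin p))).Nonempty :=
    Finset.powersetCard_nonempty.2 (by simpa using hk)
  obtain ⟨S, hS, hmax⟩ := Finset.exists_max_image _ (fun S => ∑ i ∈ S, z i) hne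
  have hSk : S.card = k := (Finset.mem_powersetCard.1 hS).2
  refine ⟨S, hSk, ?_⟩
  obtain ⟨m, hm, hmin⟩ := Finset.exists_min_image S z (Finset.card_pos.1 (by omega))
  have hout : ∀ j ∉ S, z j ≤ z m := by
    intro j hj
    have hj' : j ∉ S.erase m := fun h => hj (Finset.mem_of_mem_erase h)
    have h := hmax (insert j (S.erase m)) (Finset.mem_powersetCard.2
      ⟨Finset.subset_univ _, by
        rw [Finset.card_insert_of_notMem hj', Finset.card_erase_of_mem hm]; omega⟩)
    simp only [Finset.sum_insert hj'] at h
    have := Finset.add_sum_erase S z hm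
    linarith
  have hsum : ∑ i, w i * (z i - z m) ≤ ∑ i, if i ∈ S then z i - z m else 0 := by
    refine Finset.sum_le_sum fun i _ => ?_
    split_ifs with hi
    · exact mul_le_of_le_one_left (sub_nonneg.2 (hmin i hi)) (hw1 i)
    · exact mul_nonpos_of_nonneg_of_nonpos (hw0 i) (sub_nonpos.2 (hout i hi))
  rw [Finset.sum_ite_mem, Finset.univ_inter, Finset.sum_sub_distrib] at hsum
  simp only [mul_sub, Finset.sum_sub_distrib, ← Finset.sum_mul, hw, Finset.sum_const, hSk,
    nsmul_eq_mul] at hsum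
  linarith

lemma weighted_sum_sq_le_vecKyFan2k_sq (hk1 : 1 ≤ k) (hk : k ≤ p) (y w : Fin p → ℝ)
    (hw0 : ∀ i, 0 ≤ w i) (hw1 : ∀ i, w i ≤ 1) (hw : ∑ i, w i = k) :
    ∑ i, w i * y i ^ 2 ≤ vecKyFan2k k y ^ 2 := by
  obtain ⟨S, hS, h⟩ := exists_card_eq_weighted_sum_le hk1 hk (fun i => y i ^ 2) w hw0 hw1 hw
  exact h.trans (sum_sq_le_vecKyFan2k_sq y hS)

lemma vecKyFan2k_sq_le_threshold (hk : k ≤ p) (x : Fin p → ℝ) (c : ℝ) :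
    vecKyFan2k k x ^ 2 ≤ k * c + ∑ i, max (x i ^ 2 - c) 0 :=
  vecKyFan2k_sq_le hk x fun _ hS => sum_le_threshold (fun i => x i ^ 2) c hS

lemma vecKyFan2k_zero (hk : k ≤ p) : vecKyFan2k k (0 : Fin p → ℝ) = 0 := by
  have := vecKyFan2k_sq_le (b := 0) hk (0 : Fin p → ℝ) (by simp)
  exact pow_eq_zero_iff two_ne_zero |>.1 (le_antisymm this (sq_nonneg _))

lemma vecKyFan2k_two_mul_le (hk : k ≤ p) (x : Fin p → ℝ) :
    vecKyFan2k k (fun i => 2 * x i) ≤ 2 * vecKyFan2k k x := by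
  refine le_of_sq_le_sq ?_ (by have := vecKyFan2k_nonneg k x; positivity)
  refine vecKyFan2k_sq_le hk _ fun S hS => ?_
  have := sum_sq_le_vecKyFan2k_sq x hS
  simp only [mul_pow, ← Finset.mul_sum]
  linarith

/-- A subgradient of the gauge norm attains the norm. -/
lemma sum_mul_eq_of_mem_vsubdiff (hk : k ≤ p) {σ v : Fin p → ℝ}
    (hv : v ∈ vsubdiff (vecKyFan2k k) σ) : ∑ i, v i * σ i = vecKyFan2k k σ := by
  have h0 := hv 0
  have h2 := hv fun i => 2 * σ i
  have h3 := vecKyFan2k_two_mul_le hk σ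
  rw [vecKyFan2k_zero hk] at h0
  have e0 : ∑ i, v i * ((0 : Fin p → ℝ) i - σ i) = -∑ i, v i * σ i := by
    simp
  have e2 : ∑ i, v i * (2 * σ i - σ i) = ∑ i, v i * σ i :=
    Finset.sum_congr rfl fun i _ => by ring
  rw [e0] at h0
  rw [e2] at h2
  linarith

/-- If `c` is a tight threshold for `σ`, subgradients satisfy a scalar inequality in each
coordinate. -/
lemma coord_le_of_mem_vsubdiff (hk : k ≤ p) {σ v : Fin p → ℝ} {c : ℝ}
    (hL : 0 < vecKyFan2k k σ)
    (hc : vecKyFan2k k σ ^ 2 = k * c + ∑ i, max (σ i ^ 2 - c) 0)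
    (hv : v ∈ vsubdiff (vecKyFan2k k) σ) (i : Fin p) (x : ℝ) :
    2 * vecKyFan2k k σ * (v i * (x - σ i)) ≤ max (x ^ 2 - c) 0 - max (σ i ^ 2 - c) 0 := by
  have h := hv (Function.update σ i x)
  have hg := vecKyFan2k_sq_le_threshold hk (Function.update σ i x) c
  have e1 : ∑ j, v j * (Function.update σ i x j - σ j) = v i * (x - σ i) := by
    rw [Finset.sum_eq_single i]
    · simp
    · intro j _ hj; simp [hj]
    · simp
  have e2 : ∑ j, max (Function.update σ i x j ^ 2 - c) 0 - ∑ j, max (σ j ^ 2 - c) 0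
      = max (x ^ 2 - c) 0 - max (σ i ^ 2 - c) 0 := by
    rw [← Finset.sum_sub_distrib, Finset.sum_eq_single i]
    · simp
    · intro j _ hj; simp [hj]
    · simp
  rw [e1] at h
  nlinarith [sq_nonneg (vecKyFan2k k (Function.update σ i x) - vecKyFan2k k σ)]

/-- Sufficient condition: `v = w σ / ‖σ‖` with weights `w` realizing the norm of `σ`. -/
lemma mem_vsubdiff_of_weights (hk1 : 1 ≤ k) (hk : k ≤ p) {σ v w : Fin p → ℝ}
    (hL : 0 < vecKyFan2k k σ) (hw0 : ∀ i, 0 ≤ w i) (hw1 : ∀ i, w i ≤ 1) (hw : ∑ i, w i = k)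
    (hwσ : ∑ i, w i * σ i ^ 2 = vecKyFan2k k σ ^ 2)
    (hv : ∀ i, v i = w i * σ i / vecKyFan2k k σ) : v ∈ vsubdiff (vecKyFan2k k) σ := by
  intro y
  set L := vecKyFan2k k σ
  have hy := weighted_sum_sq_le_vecKyFan2k_sq hk1 hk y w hw0 hw1 hw
  have hy0 := vecKyFan2k_nonneg k y
  have hcs : (∑ i, w i * σ i * y i) ^ 2 ≤ (∑ i, w i * σ i ^ 2) * ∑ i, w i * y i ^ 2 :=
    Finset.sum_sq_le_sum_mul_sum_of_sq_le_mul _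
      (fun i _ => mul_nonneg (hw0 i) (sq_nonneg _)) (fun i _ => mul_nonneg (hw0 i) (sq_nonneg _))
      (fun i _ => le_of_eq (by ring))
  have hle : ∑ i, w i * σ i * y i ≤ L * vecKyFan2k k y := by
    refine le_of_sq_le_sq ?_ (by positivity)
    rw [mul_pow]
    refine hcs.trans ?_
    rw [hwσ]
    gcongr
  have e : ∑ i, v i * (y i - σ i) = (∑ i, w i * σ i * y i) / L - L := by
    have hLL : (∑ i, w i * σ i ^ 2) / L = L := by rw [hwσ]; field_simp
    calc ∑ i, v i * (y i - σ i) = ∑ i, (w i * σ i * y i / L - w i * σ i ^ 2 / L) :=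
          Finset.sum_congr rfl fun i _ => by rw [hv]; ring
      _ = _ := by rw [Finset.sum_sub_distrib, ← Finset.sum_div, ← Finset.sum_div, hLL]
  rw [e]
  have := (div_le_iff₀' hL).2 hle
  linarith

lemma eq_of_quadratic_bound {b s d : ℝ} (hd : 0 < d)
    (h : ∀ e, |e| ≤ d → 2 * b * e ≤ 2 * s * e + e ^ 2) : b = s := by
  rcases lt_trichotomy b s with hlt | heq | hlt
  · have he : 0 < min d (s - b) := lt_min hd (by linarith)
    have := h (-min d (s - b)) (by rw [abs_neg, abs_of_pos he]; exact min_le_left _ _)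
    nlinarith [min_le_right d (s - b)]
  · exact heq
  · have he : 0 < min d (b - s) := lt_min hd (by linarith)
    have := h (min d (b - s)) (by rw [abs_of_pos he]; exact min_le_left _ _)
    nlinarith [min_le_right d (b - s)]

lemma le_of_quadratic_bound {b s : ℝ}
    (h : ∀ e, 0 ≤ e → 2 * b * e ≤ 2 * s * e + e ^ 2) : b ≤ s := by
  by_contra! hlt
  nlinarith [h (b - s) (by linarith)]

lemma sum_threeblock {a b : ℕ} (hab : a ≤ b) (hbp : b ≤ p) (τ : Fin p → ℝ) :
    ∑ i : Fin p, (if (i : ℕ) < a then 1 else if (i : ℕ) < b then τ i else 0) =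
      a + ∑ i ∈ Finset.univ.filter (fun i : Fin p => a ≤ (i : ℕ) ∧ (i : ℕ) < b), τ i := by
  have ha : ((Finset.univ.filter fun i : Fin p => (i : ℕ) < a).card : ℝ) = a := by
    rw [Fin.card_filter_val_lt, min_eq_right (hab.trans hbp)]
  rw [← ha, Finset.card_eq_sum_ones, Nat.cast_sum, Finset.sum_filter, Finset.sum_filter,
    ← Finset.sum_add_distrib]
  refine Finset.sum_congr rfl fun i _ => ?_
  by_cases h1 : (i : ℕ) < a <;> by_cases h2 : (i : ℕ) < b <;> simp [h1, h2, not_lt.1]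

end KyFan

/-- Characterization of the subdifferential of the norm `‖·‖_{k,2}` at a sorted
nonnegative nonzero vector `σ` (Lemma on `∂‖σ‖_{k,2}`).  Indices are 0-based:
`σ ⟨i-1, _⟩` is the paper's `σ_i`. -/
theorem stmt8 {p : ℕ} (σ : Fin p → ℝ) (hσ0 : σ ≠ 0)
    (hsorted : ∀ i j : Fin p, i ≤ j → σ j ≤ σ i) (hnonneg : ∀ i, 0 ≤ σ i)
    (k s t : ℕ) (hk1 : 1 ≤ k) (hk : k ≤ p) (ht1 : 1 ≤ t) (htk : t ≤ k)
    (hs : s ≤ p - k)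
    (heq : σ ⟨k - t, by omega⟩ = σ ⟨k + s - 1, by omega⟩)
    (hlt1 : ∀ _ : 1 ≤ k - t, σ ⟨k - t, by omega⟩ < σ ⟨k - t - 1, by omega⟩)
    (hlt2 : ∀ h : k + s < p, σ ⟨k + s, h⟩ < σ ⟨k + s - 1, by omega⟩)
    (v : Fin p → ℝ) :
    v ∈ vsubdiff (vecKyFan2k k) σ ↔
      ((∀ i : Fin p, (i : ℕ) < k - t → v i = σ i / vecKyFan2k k σ) ∧
        (∃ τ : Fin p → ℝ,
          (∀ i : Fin p, k - t ≤ (i : ℕ) → (i : ℕ) < k + s →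
            0 ≤ τ i ∧ τ i ≤ 1 ∧ v i = τ i * σ ⟨k - 1, by omega⟩ / vecKyFan2k k σ) ∧
          ∑ i ∈ Finset.univ.filter (fun i : Fin p => k - t ≤ (i : ℕ) ∧ (i : ℕ) < k + s),
              τ i = (t : ℝ)) ∧
        (∀ i : Fin p, k + s ≤ (i : ℕ) → v i = 0)) := by
  obtain ⟨a, ha⟩ : ∃ a, a = σ ⟨k - 1, by omega⟩ := ⟨_, rfl⟩
  have ha0 : 0 ≤ a := ha ▸ hnonneg _
  have hBlock : ∀ i : Fin p, k - t ≤ (i : ℕ) → (i : ℕ) < k + s → σ i = a := by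
    have key : ∀ i : Fin p, k - t ≤ (i : ℕ) → (i : ℕ) < k + s →
        σ i = σ ⟨k - t, by omega⟩ := fun i h1 h2 =>
      le_antisymm (hsorted _ _ (Fin.le_def.2 h1))
        (heq ▸ hsorted _ _ (Fin.le_def.2 (show (i : ℕ) ≤ k + s - 1 by omega)))
    intro i h1 h2
    rw [ha, key i h1 h2, key ⟨k - 1, by omega⟩ (show k - t ≤ k - 1 by omega)
      (show k - 1 < k + s by omega)]
  have hTop : ∀ i : Fin p, (i : ℕ) < k - t → a < σ i := by
    intro i hi
    rw [← hBlock ⟨k - t, by omega⟩ (le_refl (k - t)) (show k - t < k + s by omega)]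
    exact (hlt1 (by omega)).trans_le
      (hsorted _ _ (Fin.le_def.2 (show (i : ℕ) ≤ k - t - 1 by omega)))
  have hTail : ∀ i : Fin p, k + s ≤ (i : ℕ) → σ i < a := by
    intro i hi
    rw [← hBlock ⟨k + s - 1, by omega⟩ (show k - t ≤ k + s - 1 by omega)
      (show k + s - 1 < k + s by omega)]
    exact (hsorted _ _ (Fin.le_def.2 hi)).trans_lt (hlt2 (by omega))
  have hcard : (Finset.univ.filter fun i : Fin p => (i : ℕ) < k).card = k := by
    rw [Fin.card_filter_val_lt, min_eq_right hk]
  have hsumk := sum_sq_le_vecKyFan2k_sq σ hcard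
  have hLpos : 0 < vecKyFan2k k σ := by
    obtain ⟨j, hj⟩ := Function.ne_iff.1 hσ0
    have h0 : 0 < σ ⟨0, by omega⟩ :=
      ((hnonneg j).lt_of_ne' hj).trans_le (hsorted _ _ (Fin.le_def.2 (Nat.zero_le _)))
    have h1 := Finset.single_le_sum (f := fun i => σ i ^ 2) (fun i _ => sq_nonneg (σ i))
      (show (⟨0, by omega⟩ : Fin p) ∈ Finset.univ.filter fun i : Fin p => (i : ℕ) < k by
        simp; omega)
    have h2 : 0 < vecKyFan2k k σ ^ 2 := (pow_pos h0 2).trans_le (h1.trans hsumk)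
    exact (vecKyFan2k_nonneg k σ).lt_of_ne' (pow_ne_zero_iff two_ne_zero |>.1 h2.ne')
  have hmaxTop : ∀ i : Fin p, (i : ℕ) < k - t → max (σ i ^ 2 - a ^ 2) 0 = σ i ^ 2 - a ^ 2 :=
    fun i hi => max_eq_left (by nlinarith [hTop i hi])
  have hmaxRest : ∀ i : Fin p, k - t ≤ (i : ℕ) → max (σ i ^ 2 - a ^ 2) 0 = 0 := by
    intro i hi
    have : σ i ≤ a := by
      by_cases h : (i : ℕ) < k + s
      · exact (hBlock i hi h).le
      · exact (hTail i (not_lt.1 h)).le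
    exact max_eq_right (by nlinarith [hnonneg i])
  have hthr : vecKyFan2k k σ ^ 2 = k * a ^ 2 + ∑ i, max (σ i ^ 2 - a ^ 2) 0 := by
    refine le_antisymm (vecKyFan2k_sq_le_threshold hk σ (a ^ 2)) (le_of_eq_of_le ?_ hsumk)
    have : ∑ i ∈ Finset.univ.filter (fun i : Fin p => (i : ℕ) < k), (σ i ^ 2 - a ^ 2) =
        ∑ i, max (σ i ^ 2 - a ^ 2) 0 := by
      rw [Finset.sum_filter]
      refine Finset.sum_congr rfl fun i _ => ?_
      by_cases h1 : (i : ℕ) < k - t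
      · rw [hmaxTop i h1, if_pos (by omega)]
      · rw [hmaxRest i (not_lt.1 h1)]
        split_ifs with h2
        · rw [hBlock i (not_lt.1 h1) (by omega), sub_self]
        · rfl
    rw [← this, Finset.sum_sub_distrib, Finset.sum_const, hcard, nsmul_eq_mul]
    ring
  have hkt : ((k - t : ℕ) : ℝ) = k - t := Nat.cast_sub htk
  have hweights := sum_threeblock (show k - t ≤ k + s by omega) (show k + s ≤ p by omega)
  -- With these weights `w`, `w_i σ_i² = (σ_i² - a²)⁺ + w_i a²` in every coordinate.
  have hsplit : ∀ τ : Fin p → ℝ,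
      ∑ i : Fin p, (if (i : ℕ) < k - t then 1 else if (i : ℕ) < k + s then τ i else 0) * σ i ^ 2 =
        ∑ i, max (σ i ^ 2 - a ^ 2) 0 +
        (∑ i : Fin p, if (i : ℕ) < k - t then 1 else if (i : ℕ) < k + s then τ i else 0) *
          a ^ 2 := by
    intro τ
    rw [Finset.sum_mul, ← Finset.sum_add_distrib]
    refine Finset.sum_congr rfl fun i _ => ?_
    split_ifs with h1 h2
    · rw [hmaxTop i h1]; ring
    · rw [hmaxRest i (not_lt.1 h1), hBlock i (not_lt.1 h1) h2]; ring
    · rw [hmaxRest i (not_lt.1 h1)]; ring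
  rw [← ha]
  set L := vecKyFan2k k σ with hL
  constructor
  · intro hv
    have hcoord := coord_le_of_mem_vsubdiff hk hLpos hthr hv
    have hvTop : ∀ i : Fin p, (i : ℕ) < k - t → v i = σ i / L := by
      intro i hi
      rw [eq_div_iff hLpos.ne']
      refine eq_of_quadratic_bound (sub_pos.2 (hTop i hi)) fun e he => ?_
      have h := hcoord i (σ i + e)
      have he' := abs_le.1 he
      rw [hmaxTop i hi, max_eq_left (by nlinarith)] at h
      linarith
    have hvTail : ∀ i : Fin p, k + s ≤ (i : ℕ) → v i = 0 := by
      intro i hi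
      have hlt := hTail i hi
      have h0 := hnonneg i
      have h1 := hcoord i a
      have h2 := hcoord i (-a)
      rw [hmaxRest i (by omega)] at h1 h2
      simp only [neg_sq, sub_self, max_self] at h1 h2
      have h1' : v i * (a - σ i) ≤ 0 := by
        by_contra! h; nlinarith [mul_pos hLpos h]
      have h2' : v i * (-a - σ i) ≤ 0 := by
        by_contra! h; nlinarith [mul_pos hLpos h]
      exact le_antisymm (by by_contra! h; nlinarith [mul_pos h (sub_pos.2 hlt)])
        (by by_contra! h; nlinarith)
    have hvBlock : ∀ i : Fin p, k - t ≤ (i : ℕ) → (i : ℕ) < k + s →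
        v i * L ≤ a ∧ 0 ≤ v i * a := by
      intro i h1 h2
      have hc := hcoord i
      rw [hmaxRest i h1, hBlock i h1 h2] at hc
      constructor
      · refine le_of_quadratic_bound fun e he => ?_
        have h := hc (a + e)
        rw [max_eq_left (by nlinarith)] at h
        linarith
      · have h := hc (-a)
        simp only [neg_sq, sub_self, max_self] at h
        by_contra! hneg
        nlinarith [mul_pos_of_neg_of_neg hneg (neg_lt_zero.2 hLpos)]
    refine ⟨hvTop, ?_, hvTail⟩
    rcases ha0.eq_or_lt with ha0 | ha0
    · refine ⟨fun i => if (i : ℕ) < k then 1 else 0, fun i h1 h2 => ⟨?_, ?_, ?_⟩, ?_⟩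
      · dsimp only; split_ifs <;> norm_num
      · dsimp only; split_ifs <;> norm_num
      · rw [← ha0, mul_zero, zero_div]
        have hc := hcoord i
        rw [hmaxRest i h1, hBlock i h1 h2, ← ha0] at hc
        refine (mul_eq_zero_iff_right hLpos.ne').1
          (eq_of_quadratic_bound one_pos fun e _ => ?_)
        have h := hc e
        rw [max_eq_left (by nlinarith)] at h
        linarith
      · have h := hweights fun i => if (i : ℕ) < k then 1 else 0
        have h' : ∑ i : Fin p, (if (i : ℕ) < k - t then 1 else if (i : ℕ) < k + s then
            (if (i : ℕ) < k then 1 else 0) else 0) = (k : ℝ) := by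
          rw [← congrArg (Nat.cast (R := ℝ)) hcard, Finset.card_eq_sum_ones, Nat.cast_sum,
            Finset.sum_filter]
          refine Finset.sum_congr rfl fun i _ => ?_
          split_ifs <;> first | omega | simp
        rw [h', hkt] at h
        linarith
    · refine ⟨fun i => v i * L / a, fun i h1 h2 => ⟨?_, ?_, ?_⟩, ?_⟩
      · have := nonneg_of_mul_nonneg_left (hvBlock i h1 h2).2 ha0
        positivity
      · exact (div_le_one ha0).2 (hvBlock i h1 h2).1
      · field_simp
      · have h := hweights fun i => v i * L / a
        have hs' := hsplit fun i => v i * L / a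
        have hattain : ∑ i : Fin p, (if (i : ℕ) < k - t then 1 else if (i : ℕ) < k + s then
            v i * L / a else 0) * σ i ^ 2 = L ^ 2 := by
          rw [sq L]
          nth_rewrite 3 [hL]
          rw [← sum_mul_eq_of_mem_vsubdiff hk hv, Finset.mul_sum]
          refine Finset.sum_congr rfl fun i _ => ?_
          split_ifs with h1 h2
          · rw [hvTop i h1]; field_simp
          · rw [hBlock i (not_lt.1 h1) h2]; field_simp
          · rw [hvTail i (not_lt.1 h2)]; ring
        rw [hattain, hthr, add_comm] at hs'
        have := mul_right_cancel₀ (pow_pos ha0 2).ne' (add_left_cancel hs')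
        rw [← this, hkt] at h
        linarith
  · rintro ⟨hvTop, ⟨τ, hτ, hτsum⟩, hvTail⟩
    have hw := hweights τ
    rw [hτsum, hkt, sub_add_cancel] at hw
    refine mem_vsubdiff_of_weights hk1 hk hLpos
      (w := fun i => if (i : ℕ) < k - t then 1 else if (i : ℕ) < k + s then τ i else 0)
      (fun i => ?_) (fun i => ?_) hw ?_ (fun i => ?_)
    · split_ifs with h1 h2
      · exact zero_le_one
      · exact (hτ i (not_lt.1 h1) h2).1
      · exact le_rfl
    · split_ifs with h1 h2
      · exact le_rfl
      · exact (hτ i (not_lt.1 h1) h2).2.1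
      · exact zero_le_one
    · rw [hsplit, hw, ← hL, hthr, add_comm]
    · split_ifs with h1 h2
      · rw [hvTop i h1, one_mul]
      · rw [hBlock i (not_lt.1 h1) h2, (hτ i (not_lt.1 h1) h2).2.2]
      · rw [hvTail i (not_lt.1 h2), zero_mul, zero_div]
end
end

section
/- Let f(τ) = A(τ)τ² − 2B(τ)τ − C(τ), where A, B, C are continuous real-valued functions of τ. Suppose there are two triples of positive numbers (A̲, B̲, C̲) and (Ā, B̄, C̄) with A̲ < Ā, B̲ < B̄, C̲ < C̄. Define τ_ℓ' = ( B̲ + √(B̲² + A̲·C̲) ) / Ā and τ_u' = ( B̄ + √(B̄² + Ā·C̄) ) / A̲. Suppose further there is an interval [τ_ℓ, τ_u] with τ_ℓ ≤ τ_ℓ' ≤ τ_u' ≤ τ_u such that for all τ ∈ [τ_ℓ, τ_u], A̲ ≤ A(τ) ≤ Ā, B̲ ≤ B(τ) ≤ B̄, and C̲ ≤ C(τ) ≤ C̄. Then there exists τ* ∈ [τ_ℓ', τ_u'] (and hence in [τ_ℓ, τ_u]) such that f(τ*) = 0. -/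
noncomputable section

/-- The value at `(b + √(b² + k)) / a` of the quadratic `a t² - 2 b t`, scaled by `a`, is `k`. -/
theorem mul_quadratic_root {a k : ℝ} (b : ℝ) (ha : a ≠ 0) (hk : 0 ≤ b ^ 2 + k) :
    a * (a * ((b + Real.sqrt (b ^ 2 + k)) / a) ^ 2 - 2 * b * ((b + Real.sqrt (b ^ 2 + k)) / a)) =
      k := by
  have hs := Real.sq_sqrt hk
  field_simp
  linear_combination hs

/-- Intermediate value theorem for "pseudo-quadratic" functions
`f(τ) = A(τ)τ² − 2B(τ)τ − C(τ)`. -/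
theorem stmt14 (A B C : ℝ → ℝ) (hA : Continuous A) (hB : Continuous B) (hC : Continuous C)
    (Al Bl Cl Au Bu Cu : ℝ)
    (hAl : 0 < Al) (hBl : 0 < Bl) (hCl : 0 < Cl)
    (hAlu : Al < Au) (hBlu : Bl < Bu) (hClu : Cl < Cu)
    (tauL tauU : ℝ)
    (htauL : tauL ≤ (Bl + Real.sqrt (Bl ^ 2 + Al * Cl)) / Au)
    (htauU : (Bu + Real.sqrt (Bu ^ 2 + Au * Cu)) / Al ≤ tauU)
    (hbound : ∀ τ ∈ Set.Icc tauL tauU,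
      Al ≤ A τ ∧ A τ ≤ Au ∧ Bl ≤ B τ ∧ B τ ≤ Bu ∧ Cl ≤ C τ ∧ C τ ≤ Cu) :
    ∃ τ ∈ Set.Icc ((Bl + Real.sqrt (Bl ^ 2 + Al * Cl)) / Au)
        ((Bu + Real.sqrt (Bu ^ 2 + Au * Cu)) / Al),
      A τ * τ ^ 2 - 2 * B τ * τ - C τ = 0 := by
  have hAu : 0 < Au := hAl.trans hAlu
  have hBu : 0 < Bu := hBl.trans hBlu
  have hCu : 0 < Cu := hCl.trans hClu
  have hle : (Bl + Real.sqrt (Bl ^ 2 + Al * Cl)) / Au ≤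
      (Bu + Real.sqrt (Bu ^ 2 + Au * Cu)) / Al := by
    gcongr
  have hl := mul_quadratic_root Bl hAu.ne' (by positivity : 0 ≤ Bl ^ 2 + Al * Cl)
  have hu := mul_quadratic_root Bu hAl.ne' (by positivity : 0 ≤ Bu ^ 2 + Au * Cu)
  have hl0 : 0 < (Bl + Real.sqrt (Bl ^ 2 + Al * Cl)) / Au := by positivity
  generalize (Bl + Real.sqrt (Bl ^ 2 + Al * Cl)) / Au = x at *
  generalize (Bu + Real.sqrt (Bu ^ 2 + Au * Cu)) / Al = y at *
  have hy0 : 0 < y := hl0.trans_le hle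
  have hcont : ContinuousOn (fun τ => A τ * τ ^ 2 - 2 * B τ * τ - C τ) (Set.Icc x y) := by
    fun_prop
  refine intermediate_value_Icc hle hcont ⟨?_, ?_⟩
  · obtain ⟨-, hAx, hBx, -, hCx, -⟩ := hbound x ⟨htauL, hle.trans htauU⟩
    have hx : Au * x ^ 2 - 2 * Bl * x ≤ Cl := by
      refine le_of_mul_le_mul_left ?_ hAu
      rw [hl]
      nlinarith
    have hA2 := mul_le_mul_of_nonneg_right hAx (sq_nonneg x)
    have hB2 := mul_le_mul_of_nonneg_right hBx hl0.le
    linarith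
  · obtain ⟨hAy, -, -, hBy, -, hCy⟩ := hbound y ⟨htauL.trans hle, htauU⟩
    have hy : Cu ≤ Al * y ^ 2 - 2 * Bu * y := by
      refine le_of_mul_le_mul_left ?_ hAl
      rw [hu]
      nlinarith
    have hA2 := mul_le_mul_of_nonneg_right hAy (sq_nonneg y)
    have hB2 := mul_le_mul_of_nonneg_right hBy hy0.le
    linarith
end
end

section
/- Let φ > 0, μ ≥ 0, and let a, c be real numbers with 0 ≤ a ≤ 1, 0 ≤ c, and a + c ≤ 1. Let τ ≥ 0 satisfy μφτ ≤ 1. Define g(τ; x) = φ²τ² − 2xφτ(1 − μφτ) + (1 − μφτ)². Then there exists p ∈ [a, 1] such that g(τ; p)² = g(τ; a + c) · g(τ; a − c). -/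
/-- For `g(τ; x) = φ²τ² − 2xφτ(1 − μφτ) + (1 − μφτ)²` with `0 ≤ a ≤ 1`, `0 ≤ c`,
`a + c ≤ 1`, `τ ≥ 0` and `μφτ ≤ 1`, there exists `p ∈ [a, 1]` with
`g(τ; p)² = g(τ; a + c) · g(τ; a − c)`. -/
theorem stmt17 (φ μ a c τ : ℝ) (hφ : 0 < φ) (hμ : 0 ≤ μ)
    (ha0 : 0 ≤ a) (ha1 : a ≤ 1) (hc : 0 ≤ c) (hac : a + c ≤ 1)
    (hτ : 0 ≤ τ) (h1 : μ * φ * τ ≤ 1) :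
    ∃ p, a ≤ p ∧ p ≤ 1 ∧
      (φ ^ 2 * τ ^ 2 - 2 * p * φ * τ * (1 - μ * φ * τ) + (1 - μ * φ * τ) ^ 2) ^ 2 =
        (φ ^ 2 * τ ^ 2 - 2 * (a + c) * φ * τ * (1 - μ * φ * τ) + (1 - μ * φ * τ) ^ 2) *
          (φ ^ 2 * τ ^ 2 - 2 * (a - c) * φ * τ * (1 - μ * φ * τ) + (1 - μ * φ * τ) ^ 2) := by
  have hu : 0 ≤ φ * τ := mul_nonneg hφ.le hτ
  have hv : 0 ≤ 1 - μ * φ * τ := sub_nonneg.mpr h1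
  generalize 1 - μ * φ * τ = v at hv ⊢
  have huv : 0 ≤ φ * τ * v := mul_nonneg hu hv
  have hcuv : 0 ≤ c * (φ * τ * v) := mul_nonneg hc huv
  have hg : 0 ≤ φ ^ 2 * τ ^ 2 - 2 * (a + c) * φ * τ * v + v ^ 2 := by
    nlinarith [sq_nonneg (φ * τ - v), mul_nonneg (sub_nonneg.mpr hac) huv]
  have hcont : ContinuousOn
      (fun p : ℝ => (φ ^ 2 * τ ^ 2 - 2 * p * φ * τ * v + v ^ 2) ^ 2) (Set.Icc a (a + c)) := by
    fun_prop
  obtain ⟨p, hp, hpe⟩ := intermediate_value_Icc' (le_add_of_nonneg_right hc) hcont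
    (show (φ ^ 2 * τ ^ 2 - 2 * (a + c) * φ * τ * v + v ^ 2) *
      (φ ^ 2 * τ ^ 2 - 2 * (a - c) * φ * τ * v + v ^ 2) ∈ Set.Icc _ _ from
      ⟨by linarith [mul_nonneg hg hcuv], by linarith [sq_nonneg (c * (φ * τ * v))]⟩)
  exact ⟨p, hp.1, hp.2.trans hac, hpe⟩
end

section
/- Let u ∈ ℝ^m and v ∈ ℝ^n be entrywise nonnegative vectors with Euclidean norm 1, let e_m ∈ ℝ^m and e_n ∈ ℝ^n be the all-ones vectors, and let α, β ∈ ℝ. Set T = α² + 2αβ‖u‖₁‖v‖₁ + β² m n and D = α²β² (m − ‖u‖₁²)(n − ‖v‖₁²). Then T² − 4D ≥ 0 and the squared spectral norm of the m×n matrix P = α u vᵀ + β e_m e_nᵀ is the larger root of ζ² − Tζ + D = 0, i.e., ‖P‖² = ( T + √(T² − 4D) ) / 2. -/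
open Matrix

noncomputable section

/-- The spectral norm (largest singular value) of a real matrix. -/
def specNorm {α β : Type*} [Fintype α] [Fintype β] (M : Matrix α β ℝ) : ℝ :=
  sSup {r | ∃ x : β → ℝ, ∑ j, x j ^ 2 ≤ 1 ∧ r = Real.sqrt (∑ i, (M.mulVec x) i ^ 2)}

/-- The larger eigenvalue of the symmetric matrix `!![A, B; B, C]`. -/
def topEigenvalue (A B C : ℝ) : ℝ := (A + C + √((A - C) ^ 2 + 4 * B ^ 2)) / 2

lemma topEigenvalue_charpoly (A B C : ℝ) :
    (topEigenvalue A B C - A) * (topEigenvalue A B C - C) = B ^ 2 := by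
  have h := Real.sq_sqrt (show 0 ≤ (A - C) ^ 2 + 4 * B ^ 2 by positivity)
  unfold topEigenvalue
  linear_combination h / 4

lemma le_topEigenvalue (A B C : ℝ) : A ≤ topEigenvalue A B C ∧ C ≤ topEigenvalue A B C := by
  have h : |A - C| ≤ √((A - C) ^ 2 + 4 * B ^ 2) := Real.abs_le_sqrt (by nlinarith [sq_nonneg B])
  obtain ⟨h₁, h₂⟩ := abs_le.mp h
  unfold topEigenvalue
  constructor <;> linarith

lemma quadratic_le_topEigenvalue (A B C s r : ℝ) :
    A * s ^ 2 + 2 * B * s * r + C * r ^ 2 ≤ topEigenvalue A B C * (s ^ 2 + r ^ 2) := by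
  have hdet := topEigenvalue_charpoly A B C
  obtain ⟨hA, hC⟩ := le_topEigenvalue A B C
  set l := topEigenvalue A B C
  rcases hA.eq_or_lt with h | h
  · have hB : B = 0 := by
      rw [← h] at hdet
      simpa using hdet.symm
    subst hB
    nlinarith [mul_nonneg (sub_nonneg.mpr hC) (sq_nonneg r)]
  · have key : 0 ≤ (l - A) * (l * (s ^ 2 + r ^ 2) - (A * s ^ 2 + 2 * B * s * r + C * r ^ 2)) := by
      have : (l - A) * (l * (s ^ 2 + r ^ 2) - (A * s ^ 2 + 2 * B * s * r + C * r ^ 2)) =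
          ((l - A) * s - B * r) ^ 2 := by
        linear_combination r ^ 2 * hdet
      rw [this]
      positivity
    linarith [nonneg_of_mul_nonneg_right key (sub_pos.mpr h)]

lemma exists_quadratic_eq_topEigenvalue (A B C : ℝ) :
    ∃ s r : ℝ, s ^ 2 + r ^ 2 = 1 ∧
      A * s ^ 2 + 2 * B * s * r + C * r ^ 2 = topEigenvalue A B C := by
  have hdet := topEigenvalue_charpoly A B C
  set l := topEigenvalue A B C
  by_cases h : B ^ 2 + (l - A) ^ 2 = 0
  · have hl : l = A := by nlinarith [sq_nonneg B, sq_nonneg (l - A)]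
    exact ⟨1, 0, by norm_num, by rw [hl]; ring⟩
  · have hN : √(B ^ 2 + (l - A) ^ 2) ^ 2 = B ^ 2 + (l - A) ^ 2 := Real.sq_sqrt (by positivity)
    set N := √(B ^ 2 + (l - A) ^ 2)
    have hN0 : N ≠ 0 := by
      rintro h0
      rw [h0] at hN
      exact h (by linarith)
    refine ⟨B / N, (l - A) / N, ?_, ?_⟩
    · field_simp
      linarith
    · field_simp
      rw [hN]
      linear_combination (A - l) * hdet

lemma specNorm_eq_sqrt {m n : Type*} [Fintype m] [Fintype n] {M : Matrix m n ℝ} {l : ℝ}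
    (hle : ∀ x : n → ℝ, x ⬝ᵥ x ≤ 1 → M *ᵥ x ⬝ᵥ M *ᵥ x ≤ l)
    (hex : ∃ x : n → ℝ, x ⬝ᵥ x ≤ 1 ∧ M *ᵥ x ⬝ᵥ M *ᵥ x = l) :
    specNorm M = √l := by
  simp only [dotProduct, ← sq] at hle hex
  refine IsGreatest.csSup_eq ⟨?_, ?_⟩
  · obtain ⟨x, hx, rfl⟩ := hex
    exact ⟨x, hx, rfl⟩
  · rintro _ ⟨x, hx, rfl⟩
    exact Real.sqrt_le_sqrt (hle x hx)

/-- Bessel's inequality for a unit vector `v` and a vector `f` orthogonal to it that is either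
a unit vector or zero. -/
lemma sq_dotProduct_add_sq_dotProduct_le {n : Type*} [Fintype n] {v f : n → ℝ}
    (hv : v ⬝ᵥ v = 1) (hvf : v ⬝ᵥ f = 0) (hf : f ⬝ᵥ f = 1 ∨ f = 0) (x : n → ℝ) :
    (v ⬝ᵥ x) ^ 2 + (f ⬝ᵥ x) ^ 2 ≤ x ⬝ᵥ x := by
  have h : 0 ≤ (x - (v ⬝ᵥ x) • v - (f ⬝ᵥ x) • f) ⬝ᵥ (x - (v ⬝ᵥ x) • v - (f ⬝ᵥ x) • f) :=
    Finset.sum_nonneg fun i _ => mul_self_nonneg _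
  simp only [sub_dotProduct, dotProduct_sub, smul_dotProduct, dotProduct_smul, smul_eq_mul, hv,
    hvf, dotProduct_comm x v, dotProduct_comm x f, dotProduct_comm f v] at h
  rcases hf with hf | rfl
  · rw [hf] at h
    linarith
  · simp only [zero_dotProduct] at h ⊢
    linarith

/-- Gram-Schmidt applied to `v` and the all-ones vector. -/
lemma exists_one_eq_smul_add_smul {n : Type*} [Fintype n] {v : n → ℝ} (hv : v ⬝ᵥ v = 1) :
    ∃ (f : n → ℝ) (k : ℝ), k ^ 2 = Fintype.card n - (v ⬝ᵥ 1) ^ 2 ∧ v ⬝ᵥ f = 0 ∧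
      (1 : n → ℝ) = (v ⬝ᵥ 1) • v + k • f ∧ (f ⬝ᵥ f = 1 ∨ k = 0 ∧ f = 0) := by
  set b := v ⬝ᵥ 1 with hb
  set w : n → ℝ := 1 - b • v with hw
  have hww : w ⬝ᵥ w = Fintype.card n - b ^ 2 := by
    have h1 : (1 : n → ℝ) ⬝ᵥ 1 = Fintype.card n := by simp
    simp only [hw, sub_dotProduct, dotProduct_sub, smul_dotProduct, dotProduct_smul, smul_eq_mul,
      hv, dotProduct_comm 1 v, ← hb, h1]
    ring
  have hvw : v ⬝ᵥ w = 0 := by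
    simp only [hw, dotProduct_sub, dotProduct_smul, smul_eq_mul, hv, ← hb]
    ring
  have hnn : 0 ≤ w ⬝ᵥ w := Finset.sum_nonneg fun i _ => mul_self_nonneg _
  have hk := Real.sq_sqrt hnn
  by_cases h0 : w ⬝ᵥ w = 0
  · have hw0 : w = 0 := dotProduct_self_eq_zero.mp h0
    refine ⟨0, 0, by rw [← hww, h0]; ring, by simp, ?_, by simp⟩
    rw [hw] at hw0
    simpa using sub_eq_zero.mp hw0
  · have hk0 : √(w ⬝ᵥ w) ≠ 0 := fun h => h0 (by rw [← hk, h]; ring)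
    refine ⟨(√(w ⬝ᵥ w))⁻¹ • w, √(w ⬝ᵥ w), by rw [hk, hww], by simp [hvw], ?_, .inl ?_⟩
    · rw [smul_inv_smul₀ hk0, hw]
      abel
    · rw [smul_dotProduct, dotProduct_smul, smul_eq_mul, smul_eq_mul]
      field_simp
      exact hk.symm

lemma dotProduct_mulVec_rankOne_add_const {m n : Type*} [Fintype m] [Fintype n] {u : m → ℝ}
    (hu : u ⬝ᵥ u = 1) (v : n → ℝ) (α β : ℝ) (x : n → ℝ) :
    (Matrix.of fun i j => α * u i * v j + β) *ᵥ x ⬝ᵥ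
        (Matrix.of fun i j => α * u i * v j + β) *ᵥ x =
      α ^ 2 * (v ⬝ᵥ x) ^ 2 + 2 * α * β * (u ⬝ᵥ 1) * (v ⬝ᵥ x) * (1 ⬝ᵥ x) +
        β ^ 2 * Fintype.card m * (1 ⬝ᵥ x) ^ 2 := by
  have h : (Matrix.of fun i j => α * u i * v j + β) *ᵥ x =
      (α * (v ⬝ᵥ x)) • u + (β * (1 ⬝ᵥ x)) • (1 : m → ℝ) := by
    ext i
    simp only [mulVec, dotProduct, of_apply, Pi.add_apply, Pi.smul_apply, Pi.one_apply,
      smul_eq_mul, Finset.mul_sum, Finset.sum_mul, ← Finset.sum_add_distrib]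
    exact Finset.sum_congr rfl fun j _ => by ring
  rw [h]
  simp only [add_dotProduct, dotProduct_add, smul_dotProduct, dotProduct_smul, smul_eq_mul, hu,
    dotProduct_comm 1 u]
  have h1 : (1 : m → ℝ) ⬝ᵥ 1 = Fintype.card m := by simp
  rw [h1]
  ring

/-- For unit nonnegative vectors `u, v` and scalars `α, β`, with
`T = α² + 2αβ‖u‖₁‖v‖₁ + β²mn` and `D = α²β²(m − ‖u‖₁²)(n − ‖v‖₁²)`, one has
`T² − 4D ≥ 0` and `‖α u vᵀ + β e_m e_nᵀ‖² = (T + √(T² − 4D))/2`. -/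
theorem stmt19 {m n : ℕ} (u : Fin m → ℝ) (v : Fin n → ℝ)
    (hu0 : ∀ i, 0 ≤ u i) (hv0 : ∀ j, 0 ≤ v j)
    (hu : ∑ i, u i ^ 2 = 1) (hv : ∑ j, v j ^ 2 = 1) (α β : ℝ) :
    0 ≤ (α ^ 2 + 2 * α * β * (∑ i, |u i|) * (∑ j, |v j|) + β ^ 2 * m * n) ^ 2 -
        4 * (α ^ 2 * β ^ 2 * ((m : ℝ) - (∑ i, |u i|) ^ 2) * ((n : ℝ) - (∑ j, |v j|) ^ 2)) ∧
      specNorm (Matrix.of fun (i : Fin m) (j : Fin n) => α * u i * v j + β) ^ 2 =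
        ((α ^ 2 + 2 * α * β * (∑ i, |u i|) * (∑ j, |v j|) + β ^ 2 * m * n) +
          Real.sqrt
            ((α ^ 2 + 2 * α * β * (∑ i, |u i|) * (∑ j, |v j|) + β ^ 2 * m * n) ^ 2 -
              4 * (α ^ 2 * β ^ 2 * ((m : ℝ) - (∑ i, |u i|) ^ 2) *
                ((n : ℝ) - (∑ j, |v j|) ^ 2)))) / 2 := by
  have habsu : ∑ i, |u i| = u ⬝ᵥ 1 := by simp [dotProduct, abs_of_nonneg (hu0 _)]
  have habsv : ∑ j, |v j| = v ⬝ᵥ 1 := by simp [dotProduct, abs_of_nonneg (hv0 _)]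
  have hu' : u ⬝ᵥ u = 1 := by simpa only [dotProduct, sq] using hu
  have hv' : v ⬝ᵥ v = 1 := by simpa only [dotProduct, sq] using hv
  obtain ⟨f, k, hk, hvf, hone, hf⟩ := exists_one_eq_smul_add_smul hv'
  rw [habsu, habsv]
  set a := u ⬝ᵥ 1
  set b := v ⬝ᵥ 1
  rw [Fintype.card_fin] at hk
  obtain ⟨A, hA⟩ : ∃ A, A = α ^ 2 + 2 * α * β * a * b + β ^ 2 * m * b ^ 2 := ⟨_, rfl⟩
  obtain ⟨B, hB⟩ : ∃ B, B = α * β * a * k + β ^ 2 * m * b * k := ⟨_, rfl⟩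
  obtain ⟨C, hC⟩ : ∃ C, C = β ^ 2 * m * k ^ 2 := ⟨_, rfl⟩
  have hT : α ^ 2 + 2 * α * β * a * b + β ^ 2 * m * n = A + C := by
    rw [hA, hC, hk]
    ring
  have hdisc : (A + C) ^ 2 - 4 * (α ^ 2 * β ^ 2 * ((m : ℝ) - a ^ 2) * ((n : ℝ) - b ^ 2)) =
      (A - C) ^ 2 + 4 * B ^ 2 := by
    rw [← hk, hA, hB, hC]
    ring
  rw [hT, hdisc]
  refine ⟨by positivity, ?_⟩
  change _ = topEigenvalue A B C
  set M : Matrix (Fin m) (Fin n) ℝ := Matrix.of fun i j => α * u i * v j + β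
  have hM (x : Fin n → ℝ) : M *ᵥ x ⬝ᵥ M *ᵥ x =
      A * (v ⬝ᵥ x) ^ 2 + 2 * B * (v ⬝ᵥ x) * (f ⬝ᵥ x) + C * (f ⬝ᵥ x) ^ 2 := by
    have h1 : 1 ⬝ᵥ x = b * (v ⬝ᵥ x) + k * (f ⬝ᵥ x) := by
      rw [hone, add_dotProduct, smul_dotProduct, smul_dotProduct, smul_eq_mul, smul_eq_mul]
    rw [dotProduct_mulVec_rankOne_add_const hu', h1, Fintype.card_fin, hA, hB, hC]
    ring
  have hMnn (x : Fin n → ℝ) : 0 ≤ M *ᵥ x ⬝ᵥ M *ᵥ x :=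
    Finset.sum_nonneg fun i _ => mul_self_nonneg _
  have hex : ∃ x : Fin n → ℝ, x ⬝ᵥ x ≤ 1 ∧ M *ᵥ x ⬝ᵥ M *ᵥ x = topEigenvalue A B C := by
    rcases hf with hf | ⟨rfl, rfl⟩
    · obtain ⟨s, r, hsr, hval⟩ := exists_quadratic_eq_topEigenvalue A B C
      refine ⟨s • v + r • f, le_of_eq ?_, ?_⟩
      · simp only [add_dotProduct, dotProduct_add, smul_dotProduct, dotProduct_smul, smul_eq_mul,
          hv', hvf, hf, dotProduct_comm f v]
        linarith
      · rw [hM, ← hval]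
        simp only [dotProduct_add, dotProduct_smul, smul_eq_mul, hv', hvf, hf,
          dotProduct_comm f v]
        ring
    · have hval := hM v
      have hB0 : B = 0 := by rw [hB]; ring
      have hC0 : C = 0 := by rw [hC]; ring
      simp only [hB0, hC0, hv', zero_dotProduct] at hval ⊢
      have hA0 : 0 ≤ A := by linarith [hMnn v]
      refine ⟨v, hv'.le, ?_⟩
      rw [hval, topEigenvalue]
      norm_num [Real.sqrt_sq hA0]
  have hpos : 0 ≤ topEigenvalue A B C := by
    obtain ⟨x, -, hx⟩ := hex
    exact hx ▸ hMnn x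
  rw [specNorm_eq_sqrt (fun x hx => ?_) hex, Real.sq_sqrt hpos]
  rw [hM]
  calc _ ≤ topEigenvalue A B C * ((v ⬝ᵥ x) ^ 2 + (f ⬝ᵥ x) ^ 2) :=
        quadratic_le_topEigenvalue A B C _ _
    _ ≤ topEigenvalue A B C * 1 := by
        gcongr
        exact (sq_dotProduct_add_sq_dotProduct_le hv' hvf (hf.imp_right And.right) x).trans hx
    _ = topEigenvalue A B C := mul_one _
end
end
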